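/- (Counting lemma.) For any orderons W and U and every simple ordered graph F on k vertices, |t(F,W) − t(F,U)| ≤ 6·k!·(k choose 2)·√(d△(W,U)). -/

import Mathlib

open MeasureTheory Real Filter
open scoped ENNReal Classical

noncomputable section

/-- The unit interval `[0,1]` as a subtype of `ℝ`. -/
abbrev UI : Type := Set.Icc (0:ℝ) 1

/-- The unit square `[0,1]²`. -/
abbrev USq : Type := UI × UI

/-- An orderon: a symmetric measurable function `([0,1]²)² → [0,1]`. -/
def IsOrderon (W : USq → USq → ℝ) : Prop :=
  Measurable (Function.uncurry W) ∧ (∀ u v, W u v ∈ Set.Icc (0:ℝ) 1) ∧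
    ∀ u v, W u v = W v u

/-- The (unordered) cut norm: `sup_{S,T} |∫_{S×T} W|` over measurable `S,T ⊆ [0,1]²`. -/
def cutNorm (W : USq → USq → ℝ) : ℝ :=
  sSup {x | ∃ S T : Set USq, MeasurableSet S ∧ MeasurableSet T ∧
    x = |∫ p in S ×ˢ T, W p.1 p.2|}

/-- A measure-preserving bijection of `[0,1]²` with measure-preserving inverse. -/
def IsMPB (f : USq → USq) : Prop :=
  MeasurePreserving f volume volume ∧
  ∃ g : USq → USq, MeasurePreserving g volume volume ∧
    Function.LeftInverse g f ∧ Function.RightInverse g f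

/-- `Shift(f) = sup_{(x,a)} |x - π₁(f(x,a))|`. -/
def shiftOf (f : USq → USq) : ℝ := ⨆ u : USq, |(u.1 : ℝ) - ((f u).1 : ℝ)|

/-- The cut-shift distance `d△(W,U) = inf_f (Shift(f) + ‖W - U^f‖_□)`. -/
def csDist (W U : USq → USq → ℝ) : ℝ :=
  sInf {x | ∃ f : USq → USq, IsMPB f ∧
    x = shiftOf f + cutNorm (fun u v => W u v - U (f u) (f v))}

/-- The (induced) homomorphism density `t(F,W)` of a simple ordered graph `F` on `[k]`
(encoded as a `SimpleGraph (Fin k)`, the vertex order being that of `Fin k`) in `W`. -/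
def homDensity {k : ℕ} (F : SimpleGraph (Fin k)) (W : USq → USq → ℝ) : ℝ :=
  (k.factorial : ℝ) * ∫ v : Fin k → USq,
    ∏ p ∈ Finset.univ.filter (fun p : Fin k × Fin k => p.1 < p.2),
      ((if F.Adj p.1 p.2 then W (v p.1) (v p.2) else 1 - W (v p.1) (v p.2)) *
        (if ((v p.1).1 : ℝ) ≤ ((v p.2).1 : ℝ) then 1 else 0))

section Helpers

lemma integrable_of_measurable_of_abs_le {X : Type*} [MeasurableSpace X] {μ : Measure X}
    [IsFiniteMeasure μ] {h : X → ℝ} (hm : Measurable h) {C : ℝ} (hC : ∀ x, |h x| ≤ C) :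
    Integrable h μ :=
  Integrable.of_bound hm.aestronglyMeasurable C (Eventually.of_forall hC)

lemma abs_integral_le_of_abs_le {X : Type*} [MeasurableSpace X] {μ : Measure X}
    [IsProbabilityMeasure μ] {h : X → ℝ} {C : ℝ} (hC : ∀ x, |h x| ≤ C) :
    |∫ x, h x ∂μ| ≤ C := by
  simpa using norm_integral_le_of_norm_le_const (μ := μ) (f := h) (Eventually.of_forall hC)

lemma abs_mul_mul_le_one {x y z : ℝ} (hx : x ∈ Set.Icc (0 : ℝ) 1) (hy : y ∈ Set.Icc (0 : ℝ) 1)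
    (hz : |z| ≤ 1) : |x * y * z| ≤ 1 := by
  rw [abs_mul, abs_of_nonneg (mul_nonneg hx.1 hy.1)]
  exact mul_le_one₀ (mul_le_one₀ hx.2 hy.1 hy.2) (abs_nonneg _) hz

/-- Integrating against a `[0,1]`-valued weight is dominated by integrating over a suitable set. -/
lemma exists_integral_mul_le_setIntegral {X : Type*} [MeasurableSpace X] (μ : Measure X)
    {h : X → ℝ} (hm : Measurable h) (hi : Integrable h μ) :
    ∃ S, MeasurableSet S ∧ ∀ a : X → ℝ, Measurable a → (∀ x, a x ∈ Set.Icc (0 : ℝ) 1) →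
      ∫ x, a x * h x ∂μ ≤ ∫ x in S, h x ∂μ := by
  have hS : MeasurableSet {x | 0 < h x} := measurableSet_lt measurable_const hm
  refine ⟨_, hS, fun a ha ha1 => ?_⟩
  rw [← integral_indicator hS]
  refine integral_mono (hi.bdd_mul ha.aestronglyMeasurable (c := 1)
    (Eventually.of_forall fun x => ?_)) (hi.indicator hS) fun x => ?_
  · rw [Real.norm_eq_abs, abs_of_nonneg (ha1 x).1]; exact (ha1 x).2
  · obtain ⟨h0, h1⟩ := ha1 x
    by_cases hx : 0 < h x
    · rw [Set.indicator_of_mem (by exact hx)]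
      nlinarith
    · rw [Set.indicator_of_notMem (by exact hx)]
      nlinarith

lemma integral_mul_mul_le_of_setIntegral_le {X : Type*} [MeasurableSpace X] (μ : Measure X)
    [IsProbabilityMeasure μ] {D : X × X → ℝ} (hD : Measurable D) (hD1 : ∀ z, |D z| ≤ 1) {c : ℝ}
    (hc : ∀ S T, MeasurableSet S → MeasurableSet T → ∫ z in S ×ˢ T, D z ∂(μ.prod μ) ≤ c)
    {a b : X → ℝ} (ha : Measurable a) (ha1 : ∀ x, a x ∈ Set.Icc (0 : ℝ) 1)
    (hb : Measurable b) (hb1 : ∀ x, b x ∈ Set.Icc (0 : ℝ) 1) :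
    ∫ z, a z.1 * b z.2 * D z ∂(μ.prod μ) ≤ c := by
  have hbD : Measurable fun z : X × X => b z.2 * D z := by fun_prop
  have hbD1 : ∀ z : X × X, |b z.2 * D z| ≤ 1 := fun z => by
    simpa using abs_mul_mul_le_one (x := 1) (by simp) (hb1 z.2) (hD1 z)
  have hDi {ν : Measure (X × X)} [IsFiniteMeasure ν] : Integrable D ν :=
    integrable_of_measurable_of_abs_le hD hD1
  obtain ⟨S, hS, hSa⟩ := exists_integral_mul_le_setIntegral μ
    (h := fun x => ∫ y, b y * D (x, y) ∂μ)
    (hbD.stronglyMeasurable.integral_prod_right').measurable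
    (integrable_of_measurable_of_abs_le (hbD.stronglyMeasurable.integral_prod_right').measurable
      fun x => abs_integral_le_of_abs_le fun y => hbD1 (x, y))
  obtain ⟨T, hT, hTb⟩ := exists_integral_mul_le_setIntegral μ
    (h := fun y => ∫ x in S, D (x, y) ∂μ)
    (hD.stronglyMeasurable.integral_prod_left').measurable
    (Integrable.integral_prod_right (μ := μ.restrict S) (f := D) hDi)
  calc ∫ z, a z.1 * b z.2 * D z ∂(μ.prod μ)
      = ∫ x, a x * ∫ y, b y * D (x, y) ∂μ ∂μ := by
        rw [integral_prod _ (integrable_of_measurable_of_abs_le (by fun_prop)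
          fun z => abs_mul_mul_le_one (ha1 z.1) (hb1 z.2) (hD1 z))]
        simp_rw [mul_assoc, integral_const_mul]
    _ ≤ ∫ x in S, ∫ y, b y * D (x, y) ∂μ ∂μ := hSa a ha ha1
    _ = ∫ y, b y * ∫ x in S, D (x, y) ∂μ ∂μ := by
        rw [integral_integral_swap (f := fun x y => b y * D (x, y))
          (integrable_of_measurable_of_abs_le hbD hbD1)]
        simp_rw [integral_const_mul]
    _ ≤ ∫ y in T, ∫ x in S, D (x, y) ∂μ ∂μ := hTb b hb hb1
    _ = ∫ z in S ×ˢ T, D z ∂(μ.prod μ) := by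
        rw [setIntegral_prod _ hDi.integrableOn,
          integral_integral_swap (f := fun x y => D (x, y)) hDi]
    _ ≤ c := hc S T hS hT

/-- The cut norm controls integration against product weights with values in `[0,1]`. -/
lemma abs_integral_mul_mul_le_of_abs_setIntegral_le {X : Type*} [MeasurableSpace X]
    (μ : Measure X) [IsProbabilityMeasure μ] {D : X × X → ℝ} (hD : Measurable D)
    (hD1 : ∀ z, |D z| ≤ 1) {c : ℝ}
    (hc : ∀ S T, MeasurableSet S → MeasurableSet T → |∫ z in S ×ˢ T, D z ∂(μ.prod μ)| ≤ c)
    {a b : X → ℝ} (ha : Measurable a) (ha1 : ∀ x, a x ∈ Set.Icc (0 : ℝ) 1)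
    (hb : Measurable b) (hb1 : ∀ x, b x ∈ Set.Icc (0 : ℝ) 1) :
    |∫ z, a z.1 * b z.2 * D z ∂(μ.prod μ)| ≤ c := by
  refine abs_le'.2 ⟨integral_mul_mul_le_of_setIntegral_le μ hD hD1
    (fun S T hS hT => (le_abs_self _).trans (hc S T hS hT)) ha ha1 hb hb1, ?_⟩
  have := integral_mul_mul_le_of_setIntegral_le μ hD.neg (c := c) (by simpa using hD1)
    (fun S T hS hT => by
      simp only [Pi.neg_apply, integral_neg]
      exact (neg_le_abs _).trans (hc S T hS hT)) ha ha1 hb hb1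
  simpa only [Pi.neg_apply, mul_neg, integral_neg] using this

/-- Resampling one coordinate preserves a product probability measure. -/
lemma measurePreserving_update {ι X : Type*} [Fintype ι] [DecidableEq ι]
    [MeasurableSpace X] (μ : Measure X) [IsProbabilityMeasure μ] (i : ι) :
    MeasurePreserving (fun p : (ι → X) × X => Function.update p.1 i p.2)
      ((Measure.pi fun _ => μ).prod μ) (Measure.pi fun _ => μ) := by
  refine ⟨measurable_update', (Measure.pi_eq fun s hs => ?_).symm⟩
  have hpre : (fun p : (ι → X) × X => Function.update p.1 i p.2) ⁻¹' Set.univ.pi s =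
      (Set.univ.pi (Function.update s i Set.univ)) ×ˢ s i := by
    ext ⟨v, x⟩
    simp only [Set.mem_preimage, Set.mem_pi, Set.mem_univ, forall_const, Set.mem_prod]
    constructor
    · refine fun h => ⟨fun l => ?_, by simpa using h i⟩
      by_cases hl : l = i
      · subst hl; simp
      · simpa [hl] using h l
    · rintro ⟨h, hx⟩ l
      by_cases hl : l = i
      · subst hl; simpa using hx
      · simpa [hl] using h l
  rw [Measure.map_apply measurable_update' (MeasurableSet.univ_pi hs), hpre, Measure.prod_prod,
    Measure.pi_pi, ← Finset.mul_prod_erase _ _ (Finset.mem_univ i),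
    ← Finset.mul_prod_erase (a := i) _ (fun l => μ (s l)) (Finset.mem_univ i)]
  simp only [Function.update_self, measure_univ, one_mul]
  rw [mul_comm]
  congr 1
  refine Finset.prod_congr rfl fun l hl => ?_
  rw [Function.update_of_ne (Finset.ne_of_mem_erase hl)]

lemma integral_pi_eq_integral_update_update {ι X : Type*} [Fintype ι] [DecidableEq ι]
    [MeasurableSpace X] (μ : Measure X) [IsProbabilityMeasure μ] (i j : ι)
    {H : (ι → X) → ℝ} (hH : Measurable H) {C : ℝ} (hC : ∀ v, |H v| ≤ C) :
    ∫ v, H v ∂(Measure.pi fun _ => μ) =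
      ∫ v, ∫ z, H (Function.update (Function.update v i z.1) j z.2) ∂(μ.prod μ)
        ∂(Measure.pi fun _ => μ) := by
  have hmp := (measurePreserving_update μ j).comp
    (((measurePreserving_update μ i).prod (MeasurePreserving.id μ)).comp
      (measurePreserving_prodAssoc (Measure.pi fun _ : ι => μ) μ μ).symm)
  conv_lhs => rw [← hmp.map_eq]
  rw [integral_map hmp.measurable.aemeasurable hH.aestronglyMeasurable, integral_prod]
  · rfl
  · exact integrable_of_measurable_of_abs_le (hH.comp hmp.measurable) fun _ => hC _

lemma prod_mem_Icc {ι : Type*} (s : Finset ι) {g : ι → ℝ} (hg : ∀ i, g i ∈ Set.Icc (0 : ℝ) 1) :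
    ∏ i ∈ s, g i ∈ Set.Icc (0 : ℝ) 1 :=
  ⟨Finset.prod_nonneg fun i _ => (hg i).1,
    Finset.prod_le_one (fun i _ => (hg i).1) fun i _ => (hg i).2⟩

/-- Replacing the kernel at one pair in a product over pairs `i < j` changes the integral by at
most the cut norm of the difference of the kernels. -/
lemma abs_integral_prod_sub_update_le {ι X : Type*} [Fintype ι] [LinearOrder ι]
    [MeasurableSpace X] (μ : Measure X) [IsProbabilityMeasure μ] {P : Finset (ι × ι)}
    (hP : ∀ p ∈ P, p.1 < p.2) {M : ι × ι → X × X → ℝ} (hM : ∀ p, Measurable (M p))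
    (hM1 : ∀ p z, M p z ∈ Set.Icc (0 : ℝ) 1) {q : ι × ι} (hq : q ∈ P) {L : X × X → ℝ}
    (hL : Measurable L) (hL1 : ∀ z, L z ∈ Set.Icc (0 : ℝ) 1) {ε : ℝ}
    (hε : ∀ a b : X → ℝ, Measurable a → (∀ x, a x ∈ Set.Icc (0 : ℝ) 1) → Measurable b →
      (∀ x, b x ∈ Set.Icc (0 : ℝ) 1) →
      |∫ z, a z.1 * b z.2 * (M q z - L z) ∂(μ.prod μ)| ≤ ε) :
    |∫ v, ∏ p ∈ P, M p (v p.1, v p.2) ∂(Measure.pi fun _ => μ) -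
      ∫ v, ∏ p ∈ P, Function.update M q L p (v p.1, v p.2) ∂(Measure.pi fun _ => μ)| ≤ ε := by
  obtain ⟨i, j⟩ := q
  have hij : i < j := hP _ hq
  have hU : ∀ p, Measurable (Function.update M (i, j) L p) := fun p => by
    by_cases h : p = (i, j)
    · subst h; simpa using hL
    · simpa [h] using hM p
  have hU1 : ∀ p z, Function.update M (i, j) L p z ∈ Set.Icc (0 : ℝ) 1 := fun p z => by
    by_cases h : p = (i, j)
    · subst h; simpa using hL1 z
    · simpa [h] using hM1 p z
  have habs : ∀ {t : ℝ}, t ∈ Set.Icc (0 : ℝ) 1 → |t| ≤ 1 := fun ht => by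
    rw [abs_of_nonneg ht.1]; exact ht.2
  have hmeas : ∀ {N : ι × ι → X × X → ℝ}, (∀ p, Measurable (N p)) → ∀ Q : Finset (ι × ι),
      Measurable fun v : ι → X => ∏ p ∈ Q, N p (v p.1, v p.2) := fun hN Q =>
    Finset.measurable_prod _ fun p _ => (hN p).comp (by fun_prop)
  have hML1 : ∀ z, |M (i, j) z - L z| ≤ 1 := fun z => by
    have h1 := hM1 (i, j) z
    have h2 := hL1 z
    exact abs_le.2 ⟨by linarith [h1.1, h2.2], by linarith [h1.2, h2.1]⟩
  rw [← integral_sub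
    (integrable_of_measurable_of_abs_le (hmeas hM P) fun v =>
      habs (prod_mem_Icc _ fun p => hM1 p _))
    (integrable_of_measurable_of_abs_le (hmeas hU P) fun v =>
      habs (prod_mem_Icc _ fun p => hU1 p _))]
  have hfac : ∀ v : ι → X, ∏ p ∈ P, M p (v p.1, v p.2) -
      ∏ p ∈ P, Function.update M (i, j) L p (v p.1, v p.2) =
      (∏ p ∈ P.erase (i, j), M p (v p.1, v p.2)) * (M (i, j) (v i, v j) - L (v i, v j)) := by
    intro v
    rw [← Finset.mul_prod_erase P _ hq, ← Finset.mul_prod_erase P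
      (fun p => Function.update M (i, j) L p (v p.1, v p.2)) hq]
    have : ∏ p ∈ P.erase (i, j), Function.update M (i, j) L p (v p.1, v p.2) =
        ∏ p ∈ P.erase (i, j), M p (v p.1, v p.2) :=
      Finset.prod_congr rfl fun p hp => by
        rw [Function.update_of_ne (Finset.ne_of_mem_erase hp)]
    rw [this, Function.update_self]
    ring
  simp_rw [hfac]
  rw [integral_pi_eq_integral_update_update μ i j (C := 1)]
  rotate_left
  · exact (hmeas hM _).mul (((hM _).sub hL).comp (by fun_prop))
  · intro v
    simpa using abs_mul_mul_le_one (x := 1) (by simp)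
      (prod_mem_Icc (P.erase (i, j)) fun p => hM1 p (v p.1, v p.2)) (hML1 (v i, v j))
  refine abs_integral_le_of_abs_le fun v => ?_
  have hupd : ∀ l : ι, Measurable fun x : X => Function.update v l x := fun l =>
    measurable_update v
  refine le_trans (le_of_eq ?_) (hε
    (fun x => ∏ p ∈ (P.erase (i, j)).filter (fun p : ι × ι => p.1 = i ∨ p.2 = i),
      M p (Function.update v i x p.1, Function.update v i x p.2))
    (fun y => ∏ p ∈ (P.erase (i, j)).filter (fun p : ι × ι => ¬ (p.1 = i ∨ p.2 = i)),
      M p (Function.update v j y p.1, Function.update v j y p.2))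
    ((hmeas hM _).comp (hupd i)) (fun x => prod_mem_Icc _ fun p => hM1 p _)
    ((hmeas hM _).comp (hupd j)) (fun x => prod_mem_Icc _ fun p => hM1 p _))
  congr 1
  refine integral_congr_ae (Eventually.of_forall fun z => ?_)
  have hj : Function.update (Function.update v i z.1) j z.2 i = z.1 := by
    rw [Function.update_of_ne hij.ne, Function.update_self]
  simp only [hj, Function.update_self]
  congr 1
  rw [← Finset.prod_filter_mul_prod_filter_not (P.erase (i, j))
    (fun p : ι × ι => p.1 = i ∨ p.2 = i)]
  congr 1
  · refine Finset.prod_congr rfl fun p hp => ?_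
    obtain ⟨hp, hpi⟩ := Finset.mem_filter.1 hp
    obtain ⟨hne, hpP⟩ := Finset.mem_erase.1 hp
    have hlt := hP p hpP
    have h1 : p.1 ≠ j := by
      rintro rfl
      rcases hpi with h | h
      · exact hij.ne' h
      · exact lt_asymm hij (h ▸ hlt)
    have h2 : p.2 ≠ j := by
      rintro rfl
      rcases hpi with h | h
      · exact hne (Prod.ext h rfl)
      · exact hij.ne' h
    rw [Function.update_of_ne h1, Function.update_of_ne h2]
  · refine Finset.prod_congr rfl fun p hp => ?_
    obtain ⟨-, hpi⟩ := Finset.mem_filter.1 hp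
    push Not at hpi
    rw [Function.update_comm hij.ne, Function.update_of_ne hpi.1, Function.update_of_ne hpi.2]

/-- Telescoping over the pairs. -/
lemma abs_integral_prod_sub_integral_prod_le {ι X : Type*} [Fintype ι] [LinearOrder ι]
    [MeasurableSpace X] (μ : Measure X) [IsProbabilityMeasure μ] {P : Finset (ι × ι)}
    (hP : ∀ p ∈ P, p.1 < p.2) {M L : ι × ι → X × X → ℝ} (hM : ∀ p, Measurable (M p))
    (hM1 : ∀ p z, M p z ∈ Set.Icc (0 : ℝ) 1) (hL : ∀ p, Measurable (L p))
    (hL1 : ∀ p z, L p z ∈ Set.Icc (0 : ℝ) 1) {ε : ℝ}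
    (hε : ∀ p, ∀ a b : X → ℝ, Measurable a → (∀ x, a x ∈ Set.Icc (0 : ℝ) 1) → Measurable b →
      (∀ x, b x ∈ Set.Icc (0 : ℝ) 1) →
      |∫ z, a z.1 * b z.2 * (M p z - L p z) ∂(μ.prod μ)| ≤ ε) :
    |∫ v, ∏ p ∈ P, M p (v p.1, v p.2) ∂(Measure.pi fun _ => μ) -
      ∫ v, ∏ p ∈ P, L p (v p.1, v p.2) ∂(Measure.pi fun _ => μ)| ≤ P.card * ε := by
  have key : ∀ S ⊆ P, |∫ v, ∏ p ∈ P, M p (v p.1, v p.2) ∂(Measure.pi fun _ => μ) -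
      ∫ v, ∏ p ∈ P, S.piecewise L M p (v p.1, v p.2) ∂(Measure.pi fun _ => μ)| ≤
        S.card * ε := by
    intro S
    induction S using Finset.induction_on with
    | empty => intro _; simp
    | insert q S hqS ih =>
      intro hS
      obtain ⟨hq, hSP⟩ := Finset.insert_subset_iff.1 hS
      have hpw : ∀ p, S.piecewise L M p = L p ∨ S.piecewise L M p = M p := fun p => by
        by_cases h : p ∈ S
        · exact Or.inl (by simp [h])
        · exact Or.inr (by simp [h])
      have step := abs_integral_prod_sub_update_le μ hP (M := S.piecewise L M)
        (fun p => by rcases hpw p with h | h <;> rw [h] <;> simp [hL, hM])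
        (fun p z => by
          rcases hpw p with h | h <;> rw [h]
          · exact hL1 p z
          · exact hM1 p z) hq (hL q) (hL1 q) (ε := ε)
        (by simpa [hqS] using hε q)
      rw [Finset.piecewise_insert, Finset.card_insert_of_notMem hqS]
      push_cast
      refine (abs_sub_le _ _ _).trans ((add_le_add (ih hSP) step).trans_eq (by ring))
  have h := key P subset_rfl
  have heq : ∀ v : ι → X, ∏ p ∈ P, P.piecewise L M p (v p.1, v p.2) =
      ∏ p ∈ P, L p (v p.1, v p.2) := fun v =>
    Finset.prod_congr rfl fun p hp => by rw [Finset.piecewise_eq_of_mem _ _ _ hp]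
  simpa only [heq] using h

lemma measurable_ite_one_zero {X : Type*} [MeasurableSpace X] {p : X → Prop}
    [DecidablePred p] (hp : MeasurableSet {x | p x}) :
    Measurable fun x => if p x then (1 : ℝ) else 0 :=
  Measurable.ite hp measurable_const measurable_const

lemma ite_mem_Icc (p : Prop) [Decidable p] : (if p then (1 : ℝ) else 0) ∈ Set.Icc (0 : ℝ) 1 := by
  split_ifs <;> simp

/-- The kernel of pairs whose first coordinates are `δ`-close has integral at most `2δ`. -/
lemma integral_ite_abs_sub_le {δ : ℝ} (hδ : 0 ≤ δ) :
    ∫ z : USq × USq, (if |(z.1.1 : ℝ) - z.2.1| ≤ δ then (1 : ℝ) else 0) ≤ 2 * δ := by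
  have hm : Measurable fun z : USq × USq => if |(z.1.1 : ℝ) - z.2.1| ≤ δ then (1 : ℝ) else 0 :=
    measurable_ite_one_zero (measurableSet_le (by fun_prop) measurable_const)
  have hi : Integrable (fun z : USq × USq => if |(z.1.1 : ℝ) - z.2.1| ≤ δ then (1 : ℝ) else 0)
      (volume.prod volume) :=
    integrable_of_measurable_of_abs_le (C := 1) hm fun z => by
      rw [abs_of_nonneg (ite_mem_Icc _).1]; exact (ite_mem_Icc _).2
  rw [Measure.volume_eq_prod, integral_prod _ hi]
  refine (le_abs_self _).trans (abs_integral_le_of_abs_le fun u => ?_)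
  have hs : MeasurableSet {t : UI | |(u.1 : ℝ) - t| ≤ δ} :=
    measurableSet_le (by fun_prop) measurable_const
  have hs' : MeasurableSet {v : USq | |(u.1 : ℝ) - v.1| ≤ δ} := measurable_fst hs
  have heq : (fun v : USq => if |(u.1 : ℝ) - v.1| ≤ δ then (1 : ℝ) else 0) =
      {v : USq | |(u.1 : ℝ) - v.1| ≤ δ}.indicator 1 := by
    ext v; simp [Set.indicator_apply]
  rw [heq, integral_indicator_one hs', abs_of_nonneg measureReal_nonneg]
  have hvol : (volume : Measure USq) {v : USq | |(u.1 : ℝ) - v.1| ≤ δ} =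
      volume {t : UI | |(u.1 : ℝ) - t| ≤ δ} :=
    (measurePreserving_fst (μ := (volume : Measure UI)) (ν :=
      (volume : Measure UI))).measure_preimage hs.nullMeasurableSet
  rw [Measure.real, hvol, ← volume_image_subtype_coe measurableSet_Icc]
  refine ENNReal.toReal_le_of_le_ofReal (by linarith) ?_
  refine (measure_mono (t := Set.Icc ((u.1 : ℝ) - δ) (u.1 + δ)) ?_).trans_eq ?_
  · rintro _ ⟨t, ht, rfl⟩
    obtain ⟨h1, h2⟩ := abs_le.1 (show |(u.1 : ℝ) - t| ≤ δ from ht)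
    exact ⟨by linarith, by linarith⟩
  · rw [Real.volume_Icc]; congr 1; ring

lemma abs_integral_le_of_abs_le_ite {g : USq × USq → ℝ} (hg : Measurable g) {δ : ℝ} (hδ : 0 ≤ δ)
    (h : ∀ z : USq × USq, |g z| ≤ if |(z.1.1 : ℝ) - z.2.1| ≤ δ then (1 : ℝ) else 0) :
    |∫ z, g z| ≤ 2 * δ := by
  have hm : Measurable fun z : USq × USq => if |(z.1.1 : ℝ) - z.2.1| ≤ δ then (1 : ℝ) else 0 :=
    measurable_ite_one_zero (measurableSet_le (by fun_prop) measurable_const)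
  refine abs_integral_le_integral_abs.trans
    ((integral_mono ?_ ?_ h).trans (integral_ite_abs_sub_le hδ))
  · exact integrable_of_measurable_of_abs_le (C := 1) hg.abs fun z => by
      rw [abs_abs]; exact (h z).trans (ite_mem_Icc _).2
  · exact integrable_of_measurable_of_abs_le (C := 1) hm fun z => by
      rw [abs_of_nonneg (ite_mem_Icc _).1]; exact (ite_mem_Icc _).2

/-- The order indicator agrees with a sum of `n` rectangles outside of a strip around the
diagonal. -/
lemma abs_ite_le_sub_sum_le {n : ℕ} (hn : 0 < n) (x y : UI) :
    |(if (x : ℝ) ≤ y then (1 : ℝ) else 0) - ∑ m ∈ Finset.range n,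
      (if ⌊(n : ℝ) * x⌋₊ = m then (1 : ℝ) else 0) * (if m < ⌊(n : ℝ) * y⌋₊ then (1 : ℝ) else 0)| ≤
    if |(x : ℝ) - y| ≤ 1 / n then (1 : ℝ) else 0 := by
  have hn' : (0 : ℝ) < n := by exact_mod_cast hn
  have hx0 : 0 ≤ (n : ℝ) * x := mul_nonneg hn'.le x.2.1
  have hy0 : 0 ≤ (n : ℝ) * y := mul_nonneg hn'.le y.2.1
  have hyn : ⌊(n : ℝ) * y⌋₊ ≤ n :=
    Nat.floor_le_of_le (by simpa using mul_le_mul_of_nonneg_left y.2.2 hn'.le)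
  have hsum : ∑ m ∈ Finset.range n, (if ⌊(n : ℝ) * x⌋₊ = m then (1 : ℝ) else 0) *
      (if m < ⌊(n : ℝ) * y⌋₊ then (1 : ℝ) else 0) =
      if ⌊(n : ℝ) * x⌋₊ < ⌊(n : ℝ) * y⌋₊ then 1 else 0 := by
    simp only [ite_mul, one_mul, zero_mul, Finset.sum_ite_eq, Finset.mem_range]
    by_cases h : ⌊(n : ℝ) * x⌋₊ < ⌊(n : ℝ) * y⌋₊
    · simp [h, h.trans_le hyn]
    · simp [h]
  rw [hsum]
  by_cases h : ⌊(n : ℝ) * x⌋₊ < ⌊(n : ℝ) * y⌋₊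
  · have hxy : (x : ℝ) ≤ y := by
      by_contra! hlt
      exact absurd (Nat.floor_le_floor (mul_le_mul_of_nonneg_left hlt.le hn'.le)) (not_le.2 h)
    simp only [h, hxy, if_true, sub_self, abs_zero]
    exact (ite_mem_Icc _).1
  · by_cases hxy : (x : ℝ) ≤ y
    · have heq : ⌊(n : ℝ) * x⌋₊ = ⌊(n : ℝ) * y⌋₊ :=
        le_antisymm (Nat.floor_le_floor (mul_le_mul_of_nonneg_left hxy hn'.le)) (not_lt.1 h)
      have h1 := Nat.floor_le hx0
      have h2 := Nat.lt_floor_add_one ((n : ℝ) * y)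
      rw [← heq] at h2
      have hclose : |(x : ℝ) - y| ≤ 1 / n := by
        rw [abs_sub_comm, abs_of_nonneg (by linarith), le_div_iff₀ hn']
        nlinarith
      simp only [h, hxy, hclose, if_true, if_false, sub_zero, abs_one, le_refl]
    · simp only [h, hxy, if_false, sub_self, abs_zero]
      exact (ite_mem_Icc _).1

lemma abs_integral_mul_mul_mul_ite_le {D : USq × USq → ℝ} (hD : Measurable D)
    (hD1 : ∀ z, |D z| ≤ 1) {c : ℝ}
    (hc : ∀ S T, MeasurableSet S → MeasurableSet T → |∫ z in S ×ˢ T, D z| ≤ c)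
    {a b : USq → ℝ} (ha : Measurable a) (ha1 : ∀ x, a x ∈ Set.Icc (0 : ℝ) 1)
    (hb : Measurable b) (hb1 : ∀ x, b x ∈ Set.Icc (0 : ℝ) 1) {n : ℕ} (hn : 0 < n) :
    |∫ z : USq × USq, a z.1 * b z.2 * D z * (if (z.1.1 : ℝ) ≤ z.2.1 then 1 else 0)| ≤
      n * c + 2 / n := by
  set A : ℕ → USq → ℝ := fun m u => if ⌊(n : ℝ) * u.1⌋₊ = m then (1 : ℝ) else 0 with hA
  set B : ℕ → USq → ℝ := fun m u => if m < ⌊(n : ℝ) * u.1⌋₊ then (1 : ℝ) else 0 with hB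
  have hfl : Measurable fun u : USq => ⌊(n : ℝ) * u.1⌋₊ := Nat.measurable_floor.comp (by fun_prop)
  have hAm : ∀ m, Measurable (A m) := fun m =>
    measurable_ite_one_zero (p := fun u : USq => ⌊(n : ℝ) * u.1⌋₊ = m)
      (hfl (measurableSet_singleton m))
  have hBm : ∀ m, Measurable (B m) := fun m =>
    measurable_ite_one_zero (p := fun u : USq => m < ⌊(n : ℝ) * u.1⌋₊)
      (hfl (measurableSet_Ioi (a := m)))
  have hT : Measurable fun z : USq × USq => if (z.1.1 : ℝ) ≤ z.2.1 then (1 : ℝ) else 0 :=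
    measurable_ite_one_zero (measurableSet_le (by fun_prop) (by fun_prop))
  have hAB : ∀ m, |∫ z : USq × USq, (a z.1 * A m z.1) * (b z.2 * B m z.2) * D z| ≤ c := fun m =>
    abs_integral_mul_mul_le_of_abs_setIntegral_le volume hD hD1 hc
      (a := fun u => a u * A m u) (b := fun u => b u * B m u) (ha.mul (hAm m))
      (fun x => ⟨mul_nonneg (ha1 x).1 (ite_mem_Icc _).1,
        mul_le_one₀ (ha1 x).2 (ite_mem_Icc _).1 (ite_mem_Icc _).2⟩) (hb.mul (hBm m))
      (fun x => ⟨mul_nonneg (hb1 x).1 (ite_mem_Icc _).1,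
        mul_le_one₀ (hb1 x).2 (ite_mem_Icc _).1 (ite_mem_Icc _).2⟩)
  have hABi : ∀ m, Integrable
      fun z : USq × USq => (a z.1 * A m z.1) * (b z.2 * B m z.2) * D z := fun m => by
    have := hAm m
    have := hBm m
    exact integrable_of_measurable_of_abs_le (C := 1) (by fun_prop) fun z =>
      abs_mul_mul_le_one
        ⟨mul_nonneg (ha1 _).1 (ite_mem_Icc _).1,
          mul_le_one₀ (ha1 _).2 (ite_mem_Icc _).1 (ite_mem_Icc _).2⟩
        ⟨mul_nonneg (hb1 _).1 (ite_mem_Icc _).1,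
          mul_le_one₀ (hb1 _).2 (ite_mem_Icc _).1 (ite_mem_Icc _).2⟩
        (hD1 z)
  set r : USq × USq → ℝ := fun z => a z.1 * b z.2 * D z *
    ((if (z.1.1 : ℝ) ≤ z.2.1 then (1 : ℝ) else 0) -
      ∑ m ∈ Finset.range n, A m z.1 * B m z.2) with hr
  have hrm : Measurable r := by
    refine (show Measurable fun z : USq × USq => a z.1 * b z.2 * D z by fun_prop).mul
      (hT.sub (Finset.measurable_sum _ fun m _ => ?_))
    exact ((hAm m).comp measurable_fst).mul ((hBm m).comp measurable_snd)
  have hrb : ∀ z : USq × USq, |r z| ≤ if |(z.1.1 : ℝ) - z.2.1| ≤ 1 / n then (1 : ℝ) else 0 := by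
    intro z
    rw [hr, abs_mul]
    refine (mul_le_of_le_one_left (abs_nonneg _)
      (abs_mul_mul_le_one (ha1 z.1) (hb1 z.2) (hD1 z))).trans ?_
    exact abs_ite_le_sub_sum_le hn z.1.1 z.2.1
  have hri : Integrable r :=
    integrable_of_measurable_of_abs_le (C := 1) hrm fun z => (hrb z).trans (ite_mem_Icc _).2
  have hsplit : ∀ z : USq × USq,
      a z.1 * b z.2 * D z * (if (z.1.1 : ℝ) ≤ z.2.1 then 1 else 0) =
      ∑ m ∈ Finset.range n, (a z.1 * A m z.1) * (b z.2 * B m z.2) * D z + r z := by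
    intro z
    rw [hr]
    simp only [mul_sub, Finset.mul_sum]
    rw [add_sub_left_comm, ← Finset.sum_sub_distrib, Finset.sum_eq_zero, add_zero]
    intro m _
    ring
  simp_rw [hsplit]
  rw [integral_add (integrable_finsetSum _ fun m _ => hABi m) hri,
    integral_finsetSum _ fun m _ => hABi m]
  refine (abs_add_le _ _).trans (add_le_add ?_ ?_)
  · refine (Finset.abs_sum_le_sum_abs _ _).trans ((Finset.sum_le_sum fun m _ => hAB m).trans ?_)
    simp
  · exact (abs_integral_le_of_abs_le_ite hrm (by positivity) hrb).trans_eq (by ring)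

/-- Two ordered kernels which are close in cut norm, the order of the second one being perturbed
by a map with small shift, are close against product weights. -/
lemma abs_integral_mul_mul_ordered_sub_le {W V : USq × USq → ℝ} (hW : Measurable W)
    (hW1 : ∀ z, W z ∈ Set.Icc (0 : ℝ) 1) (hV : Measurable V)
    (hV1 : ∀ z, V z ∈ Set.Icc (0 : ℝ) 1) {f : USq → USq} (hf : Measurable f) {s c d : ℝ}
    (hs : ∀ u, |(u.1 : ℝ) - (f u).1| ≤ s)
    (hc : ∀ S T, MeasurableSet S → MeasurableSet T → |∫ z in S ×ˢ T, (W z - V z)| ≤ c)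
    (hd : 0 < d) (hscd : s + c ≤ d)
    {a b : USq → ℝ} (ha : Measurable a) (ha1 : ∀ x, a x ∈ Set.Icc (0 : ℝ) 1)
    (hb : Measurable b) (hb1 : ∀ x, b x ∈ Set.Icc (0 : ℝ) 1) :
    |∫ z : USq × USq, a z.1 * b z.2 * (W z * (if (z.1.1 : ℝ) ≤ z.2.1 then 1 else 0) -
      V z * (if ((f z.1).1 : ℝ) ≤ (f z.2).1 then 1 else 0))| ≤ 6 * √d := by
  have hs0 : 0 ≤ s := (abs_nonneg _).trans (hs (0, 0))
  have hc0 : 0 ≤ c := (abs_nonneg _).trans (hc ∅ ∅ .empty .empty)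
  have hd0 : 0 < √d := Real.sqrt_pos.2 hd
  have hdd : √d * √d = d := Real.mul_self_sqrt hd.le
  have hsub : ∀ {x y : ℝ}, x ∈ Set.Icc (0 : ℝ) 1 → y ∈ Set.Icc (0 : ℝ) 1 → |x - y| ≤ 1 :=
    fun hx hy => abs_le.2 ⟨by linarith [hx.1, hy.2], by linarith [hx.2, hy.1]⟩
  have hmul : ∀ {x y : ℝ}, x ∈ Set.Icc (0 : ℝ) 1 → y ∈ Set.Icc (0 : ℝ) 1 →
      x * y ∈ Set.Icc (0 : ℝ) 1 :=
    fun hx hy => ⟨mul_nonneg hx.1 hy.1, mul_le_one₀ hx.2 hy.1 hy.2⟩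
  rcases le_total 1 (√d) with h1 | h1
  · refine (abs_integral_le_of_abs_le (C := 1) fun z => ?_).trans (by linarith)
    exact abs_mul_mul_le_one (ha1 _) (hb1 _)
      (hsub (hmul (hW1 z) (ite_mem_Icc _)) (hmul (hV1 z) (ite_mem_Icc _)))
  have hT : Measurable fun z : USq × USq => if (z.1.1 : ℝ) ≤ z.2.1 then (1 : ℝ) else 0 :=
    measurable_ite_one_zero (measurableSet_le (by fun_prop) (by fun_prop))
  have hTf : Measurable fun z : USq × USq =>
      if ((f z.1).1 : ℝ) ≤ (f z.2).1 then (1 : ℝ) else 0 :=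
    measurable_ite_one_zero (measurableSet_le (by fun_prop) (by fun_prop))
  set g₁ : USq × USq → ℝ := fun z =>
    a z.1 * b z.2 * (W z - V z) * (if (z.1.1 : ℝ) ≤ z.2.1 then 1 else 0) with hg₁
  set g₂ : USq × USq → ℝ := fun z => a z.1 * b z.2 * V z *
    ((if (z.1.1 : ℝ) ≤ z.2.1 then 1 else 0) -
      (if ((f z.1).1 : ℝ) ≤ (f z.2).1 then 1 else 0)) with hg₂
  have hm₁ : Measurable g₁ := by fun_prop
  have hm₂ : Measurable g₂ := by fun_prop
  have hb₂ : ∀ z : USq × USq,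
      |g₂ z| ≤ if |(z.1.1 : ℝ) - z.2.1| ≤ 2 * s then (1 : ℝ) else 0 := by
    intro z
    rw [hg₂, abs_mul]
    refine (mul_le_of_le_one_left (abs_nonneg _) (abs_mul_mul_le_one (ha1 z.1) (hb1 z.2)
      (by rw [abs_of_nonneg (hV1 z).1]; exact (hV1 z).2))).trans ?_
    obtain ⟨h1, h2⟩ := abs_le.1 (hs z.1)
    obtain ⟨h3, h4⟩ := abs_le.1 (hs z.2)
    by_cases hclose : |(z.1.1 : ℝ) - z.2.1| ≤ 2 * s
    · rw [if_pos hclose]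
      exact hsub (ite_mem_Icc _) (ite_mem_Icc _)
    · have hiff : (z.1.1 : ℝ) ≤ z.2.1 ↔ ((f z.1).1 : ℝ) ≤ (f z.2).1 := by
        rcases lt_abs.1 (not_le.1 hclose) with h | h
        · exact iff_of_false (by linarith) (by linarith)
        · exact iff_of_true (by linarith) (by linarith)
      simp [hiff, hclose]
  have hi₁ : Integrable g₁ := integrable_of_measurable_of_abs_le (C := 1) hm₁ fun z => by
    rw [hg₁, abs_mul, abs_of_nonneg (ite_mem_Icc _).1]
    exact mul_le_one₀ (abs_mul_mul_le_one (ha1 _) (hb1 _) (hsub (hW1 z) (hV1 z)))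
      (ite_mem_Icc _).1 (ite_mem_Icc _).2
  have hi₂ : Integrable g₂ :=
    integrable_of_measurable_of_abs_le (C := 1) hm₂ fun z => (hb₂ z).trans (ite_mem_Icc _).2
  have hsplit : ∀ z : USq × USq, a z.1 * b z.2 * (W z * (if (z.1.1 : ℝ) ≤ z.2.1 then 1 else 0) -
      V z * (if ((f z.1).1 : ℝ) ≤ (f z.2).1 then 1 else 0)) = g₁ z + g₂ z := fun z => by
    rw [hg₁, hg₂]; ring
  simp_rw [hsplit]
  rw [integral_add hi₁ hi₂]
  set n : ℕ := ⌈1 / √d⌉₊ with hn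
  have hn0 : 0 < n := Nat.ceil_pos.2 (by positivity)
  have hn1 : 1 / √d ≤ n := Nat.le_ceil _
  have hn2 : (n : ℝ) < 1 / √d + 1 := Nat.ceil_lt_add_one (by positivity)
  have e₁ : |∫ z, g₁ z| ≤ n * c + 2 / n :=
    abs_integral_mul_mul_mul_ite_le (hW.sub hV) (fun z => hsub (hW1 z) (hV1 z)) hc ha ha1 hb hb1 hn0
  have e₂ : |∫ z, g₂ z| ≤ 2 * (2 * s) :=
    abs_integral_le_of_abs_le_ite hm₂ (by positivity) hb₂
  have e₃ : 2 / (n : ℝ) ≤ 2 * √d := by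
    rw [div_le_iff₀ (by exact_mod_cast hn0)]
    rw [div_le_iff₀ hd0] at hn1
    linarith
  have e₄ : (n : ℝ) * c ≤ (1 / √d + 1) * c := mul_le_mul_of_nonneg_right hn2.le hc0
  have e₅ : (1 / √d + 1) * c + 4 * s ≤ 4 * √d := by
    refine le_of_mul_le_mul_left ?_ hd0
    have : √d * ((1 / √d + 1) * c + 4 * s) = c + √d * c + √d * (4 * s) := by
      field_simp
    rw [this]
    nlinarith [mul_le_of_le_one_left hc0 h1, mul_le_of_le_one_left hs0 h1]
  have := abs_add_le (∫ z, g₁ z) (∫ z, g₂ z)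
  linarith

lemma abs_setIntegral_le_cutNorm {D : USq → USq → ℝ} (hD1 : ∀ u v, |D u v| ≤ 1) {S T : Set USq}
    (hS : MeasurableSet S) (hT : MeasurableSet T) :
    |∫ z in S ×ˢ T, D z.1 z.2| ≤ cutNorm D := by
  refine le_csSup ⟨1, ?_⟩ ⟨S, T, hS, hT, rfl⟩
  rintro _ ⟨S, T, -, -, rfl⟩
  refine (norm_setIntegral_le_of_norm_le_const (C := 1)
    (f := fun z : USq × USq => D z.1 z.2) (measure_lt_top _ _)
    fun (z : USq × USq) _ => hD1 z.1 z.2).trans ?_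
  rw [one_mul]
  exact measureReal_le_one

lemma abs_sub_le_shiftOf (f : USq → USq) (u : USq) :
    |(u.1 : ℝ) - (f u).1| ≤ shiftOf f := by
  refine le_ciSup (f := fun u : USq => |(u.1 : ℝ) - (f u).1|) ⟨1, ?_⟩ u
  rintro _ ⟨v, rfl⟩
  exact abs_le.2 ⟨by linarith [v.1.2.1, (f v).1.2.2], by linarith [v.1.2.2, (f v).1.2.1]⟩

lemma cutNorm_nonneg (D : USq → USq → ℝ) : 0 ≤ cutNorm D :=
  Real.sSup_nonneg <| by
    rintro _ ⟨S, T, -, -, rfl⟩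
    exact abs_nonneg _

lemma shiftOf_nonneg (f : USq → USq) : 0 ≤ shiftOf f :=
  Real.iSup_nonneg fun _ => abs_nonneg _

/-- The kernel of an orderon `W` associated with an edge (if `e`) or a non-edge. -/
def edgeKernel (e : Prop) (W : USq → USq → ℝ) (z : USq × USq) : ℝ :=
  if e then W z.1 z.2 else 1 - W z.1 z.2

lemma measurable_edgeKernel (e : Prop) {W : USq → USq → ℝ} (hW : IsOrderon W) :
    Measurable (edgeKernel e W) := by
  have hm : Measurable fun z : USq × USq => W z.1 z.2 := hW.1
  unfold edgeKernel
  split_ifs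
  · exact hm
  · exact hm.const_sub 1

lemma edgeKernel_mem_Icc (e : Prop) {W : USq → USq → ℝ} (hW : IsOrderon W) (z : USq × USq) :
    edgeKernel e W z ∈ Set.Icc (0 : ℝ) 1 := by
  have h := hW.2.1 z.1 z.2
  unfold edgeKernel
  split_ifs
  · exact h
  · exact ⟨by linarith [h.2], by linarith [h.1]⟩

lemma card_filter_lt (k : ℕ) :
    (Finset.univ.filter (fun p : Fin k × Fin k => p.1 < p.2)).card = k.choose 2 := by
  rw [Finset.card_filter, ← Finset.univ_product_univ, Finset.sum_product_right]
  have : ∀ j : Fin k, ∑ i : Fin k, (if i < j then 1 else 0) = (j : ℕ) := fun j => by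
    rw [← Finset.card_filter, Finset.filter_gt_eq_Iio, Fin.card_Iio]
  simp_rw [this]
  rw [Fin.sum_univ_eq_sum_range (fun i => i), Finset.sum_range_id, Nat.choose_two_right]

lemma abs_homDensity_sub_le {k : ℕ} (F : SimpleGraph (Fin k)) {W U : USq → USq → ℝ}
    (hW : IsOrderon W) (hU : IsOrderon U) {f : USq → USq} (hf : IsMPB f) {d : ℝ} (hd : 0 < d)
    (hfd : shiftOf f + cutNorm (fun u v => W u v - U (f u) (f v)) ≤ d) :
    |homDensity F W - homDensity F U| ≤ 6 * (k.factorial : ℝ) * (k.choose 2 : ℝ) * √d := by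
  have hfm : Measurable f := hf.1.measurable
  have hV : IsOrderon fun u v => U (f u) (f v) :=
    ⟨hU.1.comp (f := fun z : USq × USq => (f z.1, f z.2)) (by fun_prop), fun u v => hU.2.1 _ _,
      fun u v => hU.2.2 _ _⟩
  have hT : Measurable fun z : USq × USq => if (z.1.1 : ℝ) ≤ z.2.1 then (1 : ℝ) else 0 :=
    measurable_ite_one_zero (measurableSet_le (by fun_prop) (by fun_prop))
  have hTf : Measurable fun z : USq × USq =>
      if ((f z.1).1 : ℝ) ≤ (f z.2).1 then (1 : ℝ) else 0 :=
    measurable_ite_one_zero (measurableSet_le (by fun_prop) (by fun_prop))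
  have hmul : ∀ {x y : ℝ}, x ∈ Set.Icc (0 : ℝ) 1 → y ∈ Set.Icc (0 : ℝ) 1 →
      x * y ∈ Set.Icc (0 : ℝ) 1 :=
    fun hx hy => ⟨mul_nonneg hx.1 hy.1, mul_le_one₀ hx.2 hy.1 hy.2⟩
  have hdiff : ∀ u v, |W u v - U (f u) (f v)| ≤ 1 := fun u v => by
    have h1 := hW.2.1 u v
    have h2 := hU.2.1 (f u) (f v)
    exact abs_le.2 ⟨by linarith [h1.1, h2.2], by linarith [h1.2, h2.1]⟩
  have key := abs_integral_prod_sub_integral_prod_le (volume : Measure USq)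
    (P := Finset.univ.filter (fun p : Fin k × Fin k => p.1 < p.2))
    (M := fun p z => edgeKernel (F.Adj p.1 p.2) W z * (if (z.1.1 : ℝ) ≤ z.2.1 then 1 else 0))
    (L := fun p z => edgeKernel (F.Adj p.1 p.2) (fun u v => U (f u) (f v)) z *
      (if ((f z.1).1 : ℝ) ≤ (f z.2).1 then 1 else 0)) (ε := 6 * √d)
    (fun p hp => (Finset.mem_filter.1 hp).2)
    (fun p => (measurable_edgeKernel _ hW).mul hT)
    (fun p z => hmul (edgeKernel_mem_Icc _ hW z) (ite_mem_Icc _))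
    (fun p => (measurable_edgeKernel _ hV).mul hTf)
    (fun p z => hmul (edgeKernel_mem_Icc _ hV z) (ite_mem_Icc _))
    (fun p a b ha ha1 hb hb1 => by
      refine abs_integral_mul_mul_ordered_sub_le (measurable_edgeKernel _ hW)
        (edgeKernel_mem_Icc _ hW) (measurable_edgeKernel _ hV) (edgeKernel_mem_Icc _ hV) hfm
        (abs_sub_le_shiftOf f) (fun S T hS hT => ?_) hd hfd ha ha1 hb hb1
      have hcut := abs_setIntegral_le_cutNorm hdiff hS hT
      by_cases he : F.Adj p.1 p.2
      · simpa only [edgeKernel, he, if_true] using hcut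
      · simp only [edgeKernel, he, if_false, sub_sub_sub_cancel_left]
        rw [← abs_neg, ← integral_neg]
        simpa only [neg_sub] using hcut)
  have hUf : ∫ v : Fin k → USq, ∏ p ∈ Finset.univ.filter (fun p : Fin k × Fin k => p.1 < p.2),
      (edgeKernel (F.Adj p.1 p.2) U (v p.1, v p.2) *
        (if ((v p.1).1 : ℝ) ≤ (v p.2).1 then 1 else 0)) =
      ∫ v : Fin k → USq, ∏ p ∈ Finset.univ.filter (fun p : Fin k × Fin k => p.1 < p.2),
      (edgeKernel (F.Adj p.1 p.2) (fun u v => U (f u) (f v)) (v p.1, v p.2) *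
        (if ((f (v p.1)).1 : ℝ) ≤ (f (v p.2)).1 then 1 else 0)) := by
    have hmp : MeasurePreserving (fun (v : Fin k → USq) i => f (v i)) volume volume :=
      volume_preserving_pi fun _ => hf.1
    conv_lhs => rw [← hmp.map_eq]
    rw [integral_map hmp.measurable.aemeasurable]
    · rfl
    · refine Measurable.aestronglyMeasurable (Finset.measurable_prod _ fun p _ => ?_)
      exact ((measurable_edgeKernel _ hU).mul hT).comp
        (g := fun z => edgeKernel (F.Adj p.1 p.2) U z * (if (z.1.1 : ℝ) ≤ z.2.1 then 1 else 0))
        (f := fun v : Fin k → USq => (v p.1, v p.2)) (by fun_prop)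
  have hdens : ∀ V : USq → USq → ℝ, homDensity F V = (k.factorial : ℝ) * ∫ v : Fin k → USq,
      ∏ p ∈ Finset.univ.filter (fun p : Fin k × Fin k => p.1 < p.2),
      (edgeKernel (F.Adj p.1 p.2) V (v p.1, v p.2) *
        (if ((v p.1).1 : ℝ) ≤ (v p.2).1 then 1 else 0)) := fun V => rfl
  rw [hdens, hdens, hUf, ← mul_sub, abs_mul, Nat.abs_cast]
  rw [card_filter_lt] at key
  refine (mul_le_mul_of_nonneg_left key (Nat.cast_nonneg _)).trans_eq ?_
  ring

end Helpers

/-- Counting lemma: `|t(F,W) - t(F,U)| ≤ 6·k!·(k choose 2)·√(d△(W,U))`. -/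
theorem counting_lemma {k : ℕ} (F : SimpleGraph (Fin k))
    (W U : USq → USq → ℝ) (hW : IsOrderon W) (hU : IsOrderon U) :
    |homDensity F W - homDensity F U| ≤
      6 * (k.factorial : ℝ) * (k.choose 2 : ℝ) * Real.sqrt (csDist W U) := by
  have hne : {x | ∃ f : USq → USq, IsMPB f ∧
      x = shiftOf f + cutNorm (fun u v => W u v - U (f u) (f v))}.Nonempty :=
    ⟨_, id, ⟨MeasurePreserving.id _, id, MeasurePreserving.id _, fun _ => rfl, fun _ => rfl⟩, rfl⟩
  have h0 : 0 ≤ csDist W U := Real.sInf_nonneg <| by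
    rintro _ ⟨f, -, rfl⟩
    exact add_nonneg (shiftOf_nonneg _) (cutNorm_nonneg _)
  have hlim : Tendsto (fun d => 6 * (k.factorial : ℝ) * (k.choose 2 : ℝ) * √d)
      (nhdsWithin (csDist W U) (Set.Ioi (csDist W U)))
      (nhds (6 * (k.factorial : ℝ) * (k.choose 2 : ℝ) * √(csDist W U))) :=
    ((Real.continuous_sqrt.const_mul _).tendsto _).mono_left nhdsWithin_le_nhds
  refine ge_of_tendsto hlim ?_
  filter_upwards [self_mem_nhdsWithin] with d hd
  obtain ⟨_, ⟨f, hf, rfl⟩, hlt⟩ := exists_lt_of_csInf_lt hne hd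
  exact abs_homDensity_sub_le F hW hU hf (h0.trans_lt hd) hlt.le
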